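/- Ore's theorem: if G is a finite simple graph with p ≥ 3 vertices such that for every pair of distinct nonadjacent vertices x, y, deg(x) + deg(y) ≥ p, then G is Hamiltonian. -/

import Mathlib

/-- number of non-adjacent consecutive pairs -/
def oreGaps {V : Type*} (G : SimpleGraph V) [DecidableRel G.Adj] (n : ℕ) (f : ℕ → V) : Finset ℕ :=
  (Finset.range n).filter (fun k => ¬ G.Adj (f k) (f (k+1)))

/-- reversal of the segment i+1..j -/
def oreRho (i j k : ℕ) : ℕ := if i < k ∧ k ≤ j then i + 1 + j - k else k

theorem ore_step {V : Type*} (G : SimpleGraph V) [DecidableRel G.Adj] (n : ℕ) (f : ℕ → V)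
    (i j : ℕ) (hij : i < j) (hjn : j < n) (h1 : G.Adj (f i) (f j))
    (h2 : G.Adj (f (i+1)) (f (j+1))) (hg : ¬ G.Adj (f i) (f (i+1)) ∨ ¬ G.Adj (f j) (f (j+1))) :
    (oreGaps G n (fun k => f (oreRho i j k))).card < (oreGaps G n f).card := by
  have key : ∀ k ∈ oreGaps G n (fun k => f (oreRho i j k)), k ≠ i ∧ k ≠ j ∧ k < n ∧
      ¬ G.Adj (f (if i < k ∧ k < j then i + j - k else k))
        (f ((if i < k ∧ k < j then i + j - k else k) + 1)) := by
    intro k hk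
    simp only [oreGaps, Finset.mem_filter, Finset.mem_range] at hk
    obtain ⟨hkn, hk⟩ := hk
    have hi : k ≠ i := by
      rintro rfl
      apply hk
      have e1 : oreRho k j k = k := by simp [oreRho]
      have e2 : oreRho k j (k+1) = j := by unfold oreRho; split_ifs <;> omega
      rw [e1, e2]; exact h1
    have hj : k ≠ j := by
      rintro rfl
      apply hk
      have e1 : oreRho i k k = i + 1 := by unfold oreRho; split_ifs <;> omega
      have e2 : oreRho i k (k+1) = k + 1 := by unfold oreRho; split_ifs <;> omega
      rw [e1, e2]; exact h2
    refine ⟨hi, hj, hkn, ?_⟩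
    split_ifs with hc
    · have e1 : oreRho i j k = i + j - k + 1 := by unfold oreRho; split_ifs <;> omega
      have e2 : oreRho i j (k+1) = i + j - k := by unfold oreRho; split_ifs <;> omega
      rw [e1, e2] at hk
      exact fun h => hk h.symm
    · have e1 : oreRho i j k = k := by unfold oreRho; split_ifs <;> omega
      have e2 : oreRho i j (k+1) = k + 1 := by unfold oreRho; split_ifs <;> omega
      rwa [e1, e2] at hk
  obtain ⟨m, hm, hmij⟩ : ∃ m ∈ oreGaps G n f, m = i ∨ m = j := by
    rcases hg with h | h
    · exact ⟨i, by simp [oreGaps, h]; omega, Or.inl rfl⟩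
    · exact ⟨j, by simp [oreGaps, h]; omega, Or.inr rfl⟩
  refine lt_of_le_of_lt ?_ (Finset.card_erase_lt_of_mem hm)
  refine Finset.card_le_card_of_injOn (fun k => if i < k ∧ k < j then i + j - k else k) ?_ ?_
  · intro k hk
    obtain ⟨a, b, c, d⟩ := key k hk
    simp only [Finset.coe_erase, Set.mem_sdiff, Finset.mem_coe, Set.mem_singleton_iff, oreGaps,
      Finset.mem_filter, Finset.mem_range]
    refine ⟨⟨?_, d⟩, ?_⟩ <;> split_ifs <;> omega
  · intro k hk l hl h
    obtain ⟨a, b, c, d⟩ := key k hk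
    obtain ⟨a', b', c', d'⟩ := key l hl
    dsimp only at h
    split_ifs at h <;> omega

theorem ore_walk {V : Type*} (G : SimpleGraph V) (f : ℕ → V) (m : ℕ)
    (h : ∀ k < m, G.Adj (f k) (f (k+1))) :
    ∃ p : G.Walk (f 0) (f m), p.support = (List.range (m+1)).map f := by
  induction m with
  | zero => exact ⟨.nil, by simp⟩
  | succ m ih =>
    obtain ⟨p, hp⟩ := ih (fun k hk => h k (by omega))
    refine ⟨p.concat (h m (by omega)), ?_⟩
    rw [SimpleGraph.Walk.support_concat, hp, List.range_succ (n := m+1)]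
    simp

theorem ore_exists {V : Type*} [Fintype V] [DecidableEq V]
    (G : SimpleGraph V) [DecidableRel G.Adj] (n : ℕ) (hn : n = Fintype.card V)
    (hdeg : ∀ x y : V, x ≠ y → ¬ G.Adj x y →
      Fintype.card V ≤ G.degree x + G.degree y) (hp : 3 ≤ n) (c : ℕ) : ∀ f : ℕ → V,
      Set.InjOn f (Set.Iio n) → f n = f 0 → (oreGaps G n f).card = c →
      ∃ f : ℕ → V, Set.InjOn f (Set.Iio n) ∧ f n = f 0 ∧ ∀ k < n, G.Adj (f k) (f (k+1)) := by
  induction c using Nat.strong_induction_on with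
  | _ c ih =>
  intro f hinj hf0 hc
  by_cases hall : ∀ k < n, G.Adj (f k) (f (k+1))
  · exact ⟨f, hinj, hf0, hall⟩
  push Not at hall
  obtain ⟨i, hin, hi⟩ := hall
  have hinj1 : Set.InjOn (fun k => f (k+1)) (Set.Iio n) := by
    intro a ha b hb h
    simp only [Set.mem_Iio] at ha hb
    dsimp only at h
    by_cases ha' : a + 1 = n <;> by_cases hb' : b + 1 = n
    · omega
    · rw [ha', hf0] at h
      have := hinj (by simp; omega) (by simp; omega) h
      omega
    · rw [hb', hf0] at h
      have := hinj (by simp; omega) (by simp; omega) h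
      omega
    · have := hinj (by simp; omega) (by simp; omega) h
      omega
  have hsurj : ∀ g : ℕ → V, Set.InjOn g (Set.Iio n) → (Finset.range n).image g = Finset.univ := by
    intro g hg
    rw [← Finset.card_eq_iff_eq_univ, Finset.card_image_of_injOn (by simpa using hg)]
    simpa using hn
  have hcard : ∀ g : ℕ → V, Set.InjOn g (Set.Iio n) → ∀ x,
      G.degree x ≤ ((Finset.range n).filter (fun k => G.Adj x (g k))).card := by
    intro g hg x
    rw [← SimpleGraph.card_neighborFinset_eq_degree]
    refine le_trans (Finset.card_le_card ?_) (Finset.card_image_le (f := g))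
    intro v hv
    have := Finset.mem_univ v
    rw [← hsurj g hg] at this
    obtain ⟨k, hk, rfl⟩ := Finset.mem_image.1 this
    exact Finset.mem_image.2 ⟨k, Finset.mem_filter.2 ⟨hk, by simpa using hv⟩, rfl⟩
  have hne : f i ≠ f (i+1) := by
    intro h
    by_cases h' : i + 1 = n
    · rw [h', hf0] at h
      have := hinj (by simp; omega) (by simp; omega) h
      omega
    · have := hinj (by simp; omega) (by simp; omega) h
      omega
  obtain ⟨j, hjn, hj1, hj2⟩ : ∃ j < n, G.Adj (f i) (f j) ∧ G.Adj (f (i+1)) (f (j+1)) := by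
    by_contra hcon
    push Not at hcon
    have d1 := hcard f hinj (f i)
    have d2 := hcard _ hinj1 (f (i+1))
    have d3 := hdeg _ _ hne hi
    have hdisj : Disjoint ((Finset.range n).filter (fun k => G.Adj (f i) (f k)))
        ((Finset.range n).filter (fun k => G.Adj (f (i+1)) (f (k+1)))) := by
      rw [Finset.disjoint_left]
      intro k hk hk'
      simp only [Finset.mem_filter, Finset.mem_range] at hk hk'
      exact hcon k hk.1 hk.2 hk'.2
    have hsub : ((Finset.range n).filter (fun k => G.Adj (f i) (f k))) ∪
        ((Finset.range n).filter (fun k => G.Adj (f (i+1)) (f (k+1)))) ⊆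
        (Finset.range n).erase i := by
      intro k hk
      simp only [Finset.mem_union, Finset.mem_filter, Finset.mem_range] at hk
      simp only [Finset.mem_erase, Finset.mem_range]
      refine ⟨?_, by tauto⟩
      rintro rfl
      simp at hk
    have := Finset.card_le_card hsub
    rw [Finset.card_union_of_disjoint hdisj, Finset.card_erase_of_mem (by simpa using hin),
      Finset.card_range] at this
    omega
  have hij : i ≠ j := by rintro rfl; simp at hj1
  have main : ∀ a b, a < b → b < n → G.Adj (f a) (f b) → G.Adj (f (a+1)) (f (b+1)) →
      (¬ G.Adj (f a) (f (a+1)) ∨ ¬ G.Adj (f b) (f (b+1))) →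
      ∃ f : ℕ → V, Set.InjOn f (Set.Iio n) ∧ f n = f 0 ∧ ∀ k < n, G.Adj (f k) (f (k+1)) := by
    intro a b hab hbn h1 h2 h3
    have hlt := ore_step G n f a b hab hbn h1 h2 h3
    refine ih _ (hc ▸ hlt) _ ?_ ?_ rfl
    · intro k hk l hl h
      simp only [Set.mem_Iio] at hk hl
      have := hinj (x₁ := oreRho a b k) (x₂ := oreRho a b l)
        (by simp only [Set.mem_Iio, oreRho]; split_ifs <;> omega)
        (by simp only [Set.mem_Iio, oreRho]; split_ifs <;> omega) h
      unfold oreRho at this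
      split_ifs at this <;> omega
    · have e1 : oreRho a b n = n := by unfold oreRho; split_ifs <;> omega
      have e2 : oreRho a b 0 = 0 := by unfold oreRho; split_ifs <;> omega
      simp only [e1, e2, hf0]
  rcases lt_or_gt_of_ne hij with h | h
  · exact main i j h hjn hj1 hj2 (Or.inl hi)
  · exact main j i h hin hj1.symm hj2.symm (Or.inr hi)

/-- Ore's theorem: a finite simple graph on `p ≥ 3` vertices such
that `deg x + deg y ≥ p` for every pair of distinct nonadjacent vertices `x, y`
is Hamiltonian. -/
theorem ore_hamiltonian {V : Type*} [Fintype V] [DecidableEq V]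
    (G : SimpleGraph V) [DecidableRel G.Adj] (hp : 3 ≤ Fintype.card V)
    (hdeg : ∀ x y : V, x ≠ y → ¬ G.Adj x y →
      Fintype.card V ≤ G.degree x + G.degree y) :
    G.IsHamiltonian := by
  intro _
  obtain ⟨n, hn⟩ : ∃ n, n = Fintype.card V := ⟨_, rfl⟩
  have hn0 : 0 < n := by omega
  let e : V ≃ Fin n := Fintype.equivFinOfCardEq hn.symm
  obtain ⟨f, hinj, hf0, hadj⟩ := ore_exists G n hn hdeg (by omega) _
    (fun k => e.symm ⟨k % n, Nat.mod_lt _ hn0⟩) (by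
      intro a ha b hb h
      simp only [Set.mem_Iio] at ha hb
      simpa [Nat.mod_eq_of_lt ha, Nat.mod_eq_of_lt hb] using h) (by simp) rfl
  obtain ⟨m, rfl⟩ : ∃ m, n = m + 1 := ⟨n - 1, by omega⟩
  obtain ⟨p, hps⟩ := ore_walk G f m (fun k hk => hadj k (by omega))
  have hpath : p.IsPath := by
    rw [SimpleGraph.Walk.isPath_def, hps]
    refine List.Nodup.map_on ?_ List.nodup_range
    intro a ha b hb h
    exact hinj (by simpa using ha) (by simpa using hb) h
  have hlen : p.length = m := by
    have := p.length_support
    rw [hps] at this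
    simpa using this.symm
  have hlast : G.Adj (f m) (f 0) := hf0 ▸ hadj m (by omega)
  refine ⟨_, SimpleGraph.Walk.cons hlast p, ?_⟩
  rw [SimpleGraph.Walk.isHamiltonianCycle_iff_isCycle_and_length_eq]
  refine ⟨?_, by simp [hlen, hn]⟩
  rw [SimpleGraph.Walk.cons_isCycle_iff]
  refine ⟨hpath, ?_⟩
  intro hmem
  have := hpath.length_eq_one_of_mem_edges (Sym2.eq_swap ▸ hmem)
  omega
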